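/- Let n be even and let L be a smooth function on ℝ^{2n+1}. Then the Euler operator applied to L·β is given in coordinates by E(Lβ) = Σ_{μ,ν} (∂²L/∂p_μ∂p_ν) β_μ ∧ dp_ν − ( Σ_μ ∂²L/∂q^μ∂p_μ + Σ_μ p_μ ∂²L/∂u∂p_μ − ∂L/∂u ) β. -/

import Mathlib

noncomputable section

namespace MA

/-- Points / tangent vectors of ℝ^m. -/
abbrev Vec (m : ℕ) := Fin m → ℝ

/-- An (unbundled) differential `k`-form on ℝ^m : at each point it eats a
`k`-tuple of tangent vectors and returns a real number. -/
abbrev Form (m k : ℕ) := Vec m → (Fin k → Vec m) → ℝ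

/-- `ω` is pointwise an alternating multilinear map, i.e. a genuine exterior form. -/
def IsForm {m k : ℕ} (ω : Form m k) : Prop :=
  ∀ x : Vec m, ∃ a : AlternatingMap ℝ (Vec m) ℝ (Fin k), ∀ v, ω x v = a v

/-- Smoothness of a differential form (smoothness of all coefficients). -/
def SmoothForm {m k : ℕ} (ω : Form m k) : Prop :=
  ∀ v : Fin k → Vec m, ContDiff ℝ (⊤ : ℕ∞) fun x => ω x v

/-- Multiplication of a form by a scalar function. -/
def fsmul {m k : ℕ} (f : Vec m → ℝ) (ω : Form m k) : Form m k := fun x v => f x * ω x v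

/-- Wedge (exterior) product of differential forms. -/
def wedge {m k l : ℕ} (ω : Form m k) (η : Form m l) : Form m (k + l) := fun x v =>
  ((k.factorial * l.factorial : ℕ) : ℝ)⁻¹ *
    ∑ σ : Equiv.Perm (Fin (k + l)),
      ((Equiv.Perm.sign σ : ℤ) : ℝ) *
        (ω x fun i => v (σ (Fin.castAdd l i))) *
        (η x fun j => v (σ (Fin.natAdd k j)))

/-- Interior product (contraction) of a form with a (constant) vector. -/
def iprod {m : ℕ} (u : Vec m) : ∀ {k : ℕ}, Form m k → Form m (k - 1)
  | 0, _ => 0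
  | _ + 1, ω => fun x v => ω x (Fin.cons u v)

/-- Exterior derivative of a differential form (coordinate formula). -/
def exd {m k : ℕ} (ω : Form m k) : Form m (k + 1) := fun x v =>
  ∑ i : Fin (k + 1),
    (-1 : ℝ) ^ (i : ℕ) * fderiv ℝ (fun y => ω y fun j => v (i.succAbove j)) x (v i)

/-- Change the (propositionally equal) degree of a form. -/
def reindex {m k l : ℕ} (h : k = l) (ω : Form m k) : Form m l :=
  fun x v => ω x fun i => v (Fin.cast h i)

/-- Pullback of a differential form along a map. -/
def pullback {a b k : ℕ} (f : Vec a → Vec b) (ω : Form b k) : Form a k :=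
  fun x v => ω (f x) fun i => fderiv ℝ f x (v i)

/-- `i`-th standard basis vector of ℝ^m. -/
def basisVec {m : ℕ} (i : Fin m) : Vec m := Pi.single i 1

/-- The coordinate 1-form `dx^i`. -/
def dx {m : ℕ} (i : Fin m) : Form m 1 := fun _ v => v 0 i

/-- Partial derivative of a function in the `i`-th coordinate direction. -/
def pd {m : ℕ} (i : Fin m) (f : Vec m → ℝ) : Vec m → ℝ := fun x => fderiv ℝ f x (basisVec i)

/- Jet-space coordinates on J¹ℝⁿ = ℝ^{2n+1} : (q¹,…,qⁿ,u,p₁,…,pₙ). -/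

/-- Index of the coordinate `q^μ`. -/
def qIdx {n : ℕ} (μ : Fin n) : Fin (2 * n + 1) := ⟨μ, by have := μ.isLt; omega⟩

/-- Index of the coordinate `u`. -/
def uIdx {n : ℕ} : Fin (2 * n + 1) := ⟨n, by omega⟩

/-- Index of the coordinate `p_μ`. -/
def pIdx {n : ℕ} (μ : Fin n) : Fin (2 * n + 1) := ⟨n + 1 + μ, by have := μ.isLt; omega⟩

/-- The Reeb field `χ = ∂/∂u` (a constant vector field). -/
def chi {n : ℕ} : Vec (2 * n + 1) := basisVec uIdx

/-- The standard contact form `c = du - Σ p_μ dq^μ` on J¹ℝⁿ. -/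
def contact {n : ℕ} : Form (2 * n + 1) 1 := fun x v =>
  v 0 uIdx - ∑ μ : Fin n, x (pIdx μ) * v 0 (qIdx μ)

/-- The symplectic-type 2-form `Ω = dc = Σ dq^μ ∧ dp_μ`. -/
def symp {n : ℕ} : Form (2 * n + 1) 2 := ∑ μ : Fin n, wedge (dx (qIdx μ)) (dx (pIdx μ))

/-- The bottom operator `⊥ = Σ_μ ∂_{p_μ} ⌟ ∂_{q^μ} ⌟ ·` (zero on forms of degree ≤ 1). -/
def botOp {n k : ℕ} (ω : Form (2 * n + 1) k) : Form (2 * n + 1) (k - 2) :=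
  ∑ μ : Fin n, iprod (basisVec (pIdx μ)) (iprod (basisVec (qIdx μ)) ω)

/-- A form is effective if it is killed by `χ ⌟ ·` and by `⊥`. -/
def Effective {n k : ℕ} (ω : Form (2 * n + 1) k) : Prop :=
  iprod (chi (n := n)) ω = 0 ∧ botOp ω = 0

/-- The projection `p(α) = α - c ∧ (χ ⌟ α)` onto forms annihilated by `χ ⌟ ·`. -/
def proj {n : ℕ} : ∀ {k : ℕ}, Form (2 * n + 1) k → Form (2 * n + 1) k
  | 0, α => α
  | j + 1, α => α - reindex (Nat.add_comm 1 j) (wedge contact (iprod (chi (n := n)) α))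

/-- The projected exterior derivative `d_p = p ∘ d`. -/
def dproj {n k : ℕ} (ω : Form (2 * n + 1) k) : Form (2 * n + 1) (k + 1) := proj (exd ω)

/-- Lie derivative along the (constant) Reeb field `χ`. -/
def lieChi {n k : ℕ} (ω : Form (2 * n + 1) k) : Form (2 * n + 1) k := fun x v =>
  fderiv ℝ (fun y => ω y v) x (chi (n := n))

/-- The Euler operator `E = d_p ∘ ⊥ ∘ d_p + L_χ` on n-forms over J¹ℝⁿ. -/
def euler : ∀ {n : ℕ}, Form (2 * n + 1) n → Form (2 * n + 1) n
  | 0, ω => lieChi ω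
  | n + 1, ω =>
    reindex (show n + 1 + 1 - 2 + 1 = n + 1 by omega) (dproj (botOp (dproj ω))) + lieChi ω

/-- The horizontal volume form `β = dq¹ ∧ … ∧ dqⁿ` on J¹ℝⁿ. -/
def qvol {n : ℕ} : Form (2 * n + 1) n := fun _ v =>
  Matrix.det (Matrix.of fun i j : Fin n => v i (qIdx j))

/-- The volume form `β = dq¹ ∧ … ∧ dqⁿ` on the base ℝⁿ. -/
def baseVol {n : ℕ} : Form n n := fun _ v => Matrix.det (Matrix.of fun i j : Fin n => v i j)

/-- `β_μ = ∂_{q^μ} ⌟ β`. -/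
def betaMu {n : ℕ} (μ : Fin n) : Form (2 * n + 1) (n - 1) := iprod (basisVec (qIdx μ)) qvol

/-- The first jet prolongation `j¹φ : ℝⁿ → ℝ^{2n+1}`, `x ↦ (x, φ(x), ∂₁φ(x), …, ∂ₙφ(x))`. -/
def jet {n : ℕ} (φ : Vec n → ℝ) (x : Vec n) : Vec (2 * n + 1) := fun i =>
  if h : (i : ℕ) < n then x ⟨i, h⟩
  else if h2 : (i : ℕ) = n then φ x
  else fderiv ℝ φ x (basisVec ⟨(i : ℕ) - (n + 1), by have := i.isLt; omega⟩)

/-- Second partial derivative `φ_{μν} = ∂²φ/∂q^μ∂q^ν`. -/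
def d2 {n : ℕ} (φ : Vec n → ℝ) (μ ν : Fin n) : Vec n → ℝ := fun x =>
  fderiv ℝ (fun y => fderiv ℝ φ y (basisVec ν)) x (basisVec μ)

/-- A form is multisymplectic if it is closed and pointwise nondegenerate. -/
def Multisymplectic {m k : ℕ} (μ : Form m k) : Prop :=
  exd μ = 0 ∧ ∀ (x v : Vec m), iprod v μ x = 0 → v = 0

/-- Lift a form on J¹ℝⁿ = ℝ^{2n+1} to ℝ^{2n+2} = J¹ℝⁿ × ℝ (extra coordinate `e`)
along the projection. -/
def liftForm {n k : ℕ} (ω : Form (2 * n + 1) k) : Form (2 * n + 1 + 1) k :=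
  pullback (fun y (i : Fin (2 * n + 1)) => y i.castSucc) ω

/-- The 1-form `de` on ℝ^{2n+2}. -/
def deForm {n : ℕ} : Form (2 * n + 1 + 1) 1 := dx (Fin.last (2 * n + 1))

/-- The (n+1)-form `m_ω = de ∧ β + c ∧ ω` on ℝ^{2n+2}. -/
def msf {n : ℕ} (ω : Form (2 * n + 1) n) : Form (2 * n + 1 + 1) (n + 1) :=
  reindex (Nat.add_comm 1 n) (wedge (deForm (n := n)) (liftForm qvol)) +
    reindex (Nat.add_comm 1 n) (wedge (liftForm (contact (n := n))) (liftForm ω))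

section WedgeOneForm

variable {V : Type*}

/-- The wedge product `α ∧ a` of a one-form `α` and a `k`-form `a` at a point, expanded along `α`. -/
def oneWedge {k : ℕ} (α : V → ℝ) (a : (Fin k → V) → ℝ) (v : Fin (k + 1) → V) : ℝ :=
  ∑ i : Fin (k + 1), (-1) ^ (i : ℕ) * α (v i) * a fun j => v (i.succAbove j)

lemma oneWedge_add_left {k : ℕ} (α α' : V → ℝ) (a : (Fin k → V) → ℝ) (v : Fin (k + 1) → V) :
    oneWedge (fun w => α w + α' w) a v = oneWedge α a v + oneWedge α' a v := by
  simp only [oneWedge, ← Finset.sum_add_distrib]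
  exact Finset.sum_congr rfl fun _ _ => by ring

lemma oneWedge_smul_left {k : ℕ} (r : ℝ) (α : V → ℝ) (a : (Fin k → V) → ℝ)
    (v : Fin (k + 1) → V) :
    oneWedge (fun w => r * α w) a v = r * oneWedge α a v := by
  simp only [oneWedge, Finset.mul_sum]
  exact Finset.sum_congr rfl fun _ _ => by ring

lemma oneWedge_sub_left {k : ℕ} (α α' : V → ℝ) (a : (Fin k → V) → ℝ) (v : Fin (k + 1) → V) :
    oneWedge (fun w => α w - α' w) a v = oneWedge α a v - oneWedge α' a v := by
  simp only [oneWedge, ← Finset.sum_sub_distrib]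
  exact Finset.sum_congr rfl fun _ _ => by ring

lemma oneWedge_sum_left {ι : Type*} [Fintype ι] {k : ℕ} (α : ι → V → ℝ)
    (a : (Fin k → V) → ℝ) (v : Fin (k + 1) → V) :
    oneWedge (fun w => ∑ i, α i w) a v = ∑ i, oneWedge (α i) a v := by
  simp only [oneWedge, Finset.mul_sum, Finset.sum_mul]
  exact Finset.sum_comm

lemma oneWedge_smul_right {k : ℕ} (r : ℝ) (α : V → ℝ) (a : (Fin k → V) → ℝ)
    (v : Fin (k + 1) → V) :
    oneWedge α (fun w => r * a w) v = r * oneWedge α a v := by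
  simp only [oneWedge, Finset.mul_sum]
  exact Finset.sum_congr rfl fun _ _ => by ring

lemma oneWedge_sum_right {ι : Type*} [Fintype ι] {k : ℕ} (α : V → ℝ)
    (a : ι → (Fin k → V) → ℝ) (v : Fin (k + 1) → V) :
    oneWedge α (fun w => ∑ i, a i w) v = ∑ i, oneWedge α (a i) v := by
  simp only [oneWedge, Finset.mul_sum]
  exact Finset.sum_comm

/-- Interior product of a vector with `α ∧ a`. -/
lemma oneWedge_cons {k : ℕ} (α : V → ℝ) (a : (Fin (k + 1) → V) → ℝ) (w : V)
    (v : Fin (k + 1) → V) :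
    oneWedge α a (Fin.cons w v : Fin (k + 2) → V) =
      α w * a v - oneWedge α (fun v' => a (Fin.cons w v' : Fin (k + 1) → V)) v := by
  have h (i : Fin (k + 1)) :
      (fun j => (Fin.cons w v : Fin (k + 2) → V) (i.succ.succAbove j)) =
        (Fin.cons w (fun j => v (i.succAbove j)) : Fin (k + 1) → V) := by
    funext j
    refine Fin.cases ?_ (fun j => ?_) j <;> simp
  simp only [oneWedge]
  rw [Fin.sum_univ_succ]
  simp only [h, Fin.val_zero, pow_zero, one_mul, Fin.cons_zero, Fin.succAbove_zero, Fin.cons_succ,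
    Fin.val_succ, pow_succ, sub_eq_add_neg, ← Finset.sum_neg_distrib]
  congr 1
  exact Finset.sum_congr rfl fun _ _ => by ring

variable [AddCommGroup V] [Module ℝ V]

lemma sum_perm_eq_oneWedge {k : ℕ} (α : V → ℝ) (a : V [⋀^Fin k]→ₗ[ℝ] ℝ) (v : Fin (k + 1) → V) :
    ∑ σ : Equiv.Perm (Fin (k + 1)),
        ((Equiv.Perm.sign σ : ℤ) : ℝ) * α (v (σ 0)) * a (fun j => v (σ j.succ)) =
      k.factorial * oneWedge α a v := by
  have key (i : Fin (k + 1)) (e : Equiv.Perm (Fin k)) :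
      ((Equiv.Perm.sign (Equiv.Perm.decomposeFin.symm (i, e)) : ℤ) : ℝ) *
          a (fun j => v (Equiv.swap 0 i (e j).succ)) =
        (-1) ^ (i : ℕ) * a (fun j => v (i.succAbove j)) := by
    have he (b : Fin k → V) :
        a (fun j => b (e j)) = ((Equiv.Perm.sign e : ℤ) : ℝ) * a b := by
      have h := a.map_perm b e
      rw [Units.smul_def, zsmul_eq_mul] at h
      exact h
    have hs (e : Equiv.Perm (Fin k)) :
        ((Equiv.Perm.sign e : ℤ) : ℝ) * ((Equiv.Perm.sign e : ℤ) : ℝ) = 1 := by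
      rw [← Int.cast_mul, ← Units.val_mul, Int.units_mul_self]; simp
    rw [he fun j => v (Equiv.swap 0 i j.succ), Equiv.Perm.decomposeFin.symm_sign]
    refine Fin.cases ?_ (fun i => ?_) i
    · simp [← mul_assoc, hs]
    · obtain _ | k := k
      · exact i.elim0
      have hc := a.map_perm (fun j => v (i.succ.succAbove j)) i.cycleRange
      simp only [Function.comp_def, Fin.succAbove_cycleRange, Units.smul_def, zsmul_eq_mul,
        Fin.sign_cycleRange] at hc
      rw [hc]
      simp only [Fin.succ_ne_zero, if_false, Fin.val_succ, pow_succ]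
      push_cast
      linear_combination (-1 : ℝ) ^ (i : ℕ) * (-1) * a (fun j => v (i.succ.succAbove j)) * hs e
  rw [Finset.univ_perm_fin_succ, ← Finset.univ_product_univ]
  simp only [Finset.sum_map, Equiv.toEmbedding_apply, Finset.sum_product,
    Equiv.Perm.decomposeFin_symm_apply_zero, Equiv.Perm.decomposeFin_symm_apply_succ,
    oneWedge, Finset.mul_sum]
  refine Finset.sum_congr rfl fun i _ => ?_
  calc _ = ∑ _e : Equiv.Perm (Fin k),
        α (v i) * ((-1) ^ (i : ℕ) * a (fun j => v (i.succAbove j))) :=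
        Finset.sum_congr rfl fun e _ => by rw [← key i e]; ring
    _ = _ := by
        rw [Finset.sum_const, Finset.card_univ, Fintype.card_perm, Fintype.card_fin, nsmul_eq_mul]
        ring

end WedgeOneForm

lemma coe_sum_smul {ι V : Type*} [Fintype ι] [AddCommGroup V] [Module ℝ V] {k : ℕ} (r : ι → ℝ)
    (a : ι → V [⋀^Fin k]→ₗ[ℝ] ℝ) :
    (⇑(∑ i, r i • a i) : (Fin k → V) → ℝ) = fun w => ∑ i, r i * a i w := by
  funext w
  exact map_sum (⟨⟨fun g => g w, rfl⟩, fun _ _ => rfl⟩ : (V [⋀^Fin k]→ₗ[ℝ] ℝ) →+ ℝ) _ _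

lemma reindex_wedge_one_left {m k : ℕ} (h : 1 + k = k + 1) (ω : Form m 1) (η : Form m k)
    (x : Vec m) (a : Vec m [⋀^Fin k]→ₗ[ℝ] ℝ) (ha : η x = a) (v : Fin (k + 1) → Vec m) :
    reindex h (wedge ω η) x v = oneWedge (fun w => ω x fun _ => w) a v := by
  have hk : (k.factorial : ℝ) ≠ 0 := by exact_mod_cast k.factorial_ne_zero
  rw [← mul_right_inj' hk, ← sum_perm_eq_oneWedge]
  simp only [reindex, wedge, ha, Nat.factorial_one, one_mul]
  rw [mul_inv_cancel_left₀ hk]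
  refine Fintype.sum_equiv (Equiv.permCongr (finCongr h)) _ _ fun σ => ?_
  have h0 (i : Fin 1) : (finCongr h).symm 0 = Fin.castAdd k i := by
    ext; simp
  have h1 (j : Fin k) : (finCongr h).symm j.succ = Fin.natAdd 1 j := by
    ext; simp [add_comm]
  simp only [Equiv.Perm.sign_permCongr, Equiv.permCongr_apply, h1, ← h0, finCongr_apply]

lemma wedge_one_right {m k : ℕ} (η : Form m k) (ω : Form m 1)
    (x : Vec m) (a : Vec m [⋀^Fin k]→ₗ[ℝ] ℝ) (ha : η x = a) (v : Fin (k + 1) → Vec m) :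
    wedge η ω x v = (-1) ^ k * oneWedge (fun w => ω x fun _ => w) a v := by
  have hk : (k.factorial : ℝ) ≠ 0 := by exact_mod_cast k.factorial_ne_zero
  rw [← mul_right_inj' hk, mul_left_comm, ← sum_perm_eq_oneWedge, Finset.mul_sum]
  simp only [wedge, ha, Nat.factorial_one, mul_one]
  rw [mul_inv_cancel_left₀ hk]
  refine Fintype.sum_equiv (Equiv.mulRight (finRotate (k + 1))⁻¹) _ _ fun σ => ?_
  have h0 (i : Fin 1) : (finRotate (k + 1))⁻¹ 0 = Fin.natAdd k i := by
    rw [Equiv.Perm.inv_eq_iff_eq, show Fin.natAdd k i = Fin.last k by ext; simp, finRotate_last]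
  have h1 (j : Fin k) : (finRotate (k + 1))⁻¹ j.succ = Fin.castAdd 1 j := by
    rw [Equiv.Perm.inv_eq_iff_eq, finRotate_apply]
    exact (Fin.coeSucc_eq_succ).symm
  simp only [Equiv.coe_mulRight, Equiv.Perm.mul_apply, h1, ← h0, Equiv.Perm.sign_mul,
    Equiv.Perm.sign_inv, sign_finRotate, Nat.add_sub_cancel]
  have : ((-1 : ℝ) ^ k) * (-1) ^ k = 1 := by rw [← mul_pow]; simp
  push_cast
  linear_combination (-(Equiv.Perm.sign σ : ℤ) : ℝ) * (a fun i => v (σ (Fin.castAdd 1 i))) *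
    (ω x fun j => v (σ ((finRotate (k + 1))⁻¹ 0))) * this

/-- `d (∑ᵢ fᵢ aᵢ) = ∑ᵢ dfᵢ ∧ aᵢ` for constant forms `aᵢ`. -/
lemma exd_sum {ι : Type*} [Fintype ι] {m k : ℕ} (f : ι → Vec m → ℝ)
    (hf : ∀ i, Differentiable ℝ (f i))
    (a : ι → Vec m [⋀^Fin k]→ₗ[ℝ] ℝ) (x : Vec m) (v : Fin (k + 1) → Vec m) :
    exd (fun y w => ∑ i, f i y * a i w) x v = ∑ i, oneWedge (fderiv ℝ (f i) x) (a i) v := by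
  simp only [exd, oneWedge]
  rw [Finset.sum_comm]
  refine Finset.sum_congr rfl fun j _ => ?_
  rw [fderiv_fun_sum fun i _ => ((hf i).differentiableAt.mul_const _)]
  simp only [fderiv_mul_const (hf _).differentiableAt, Finset.mul_sum,
    _root_.sum_apply, _root_.smul_apply, smul_eq_mul]
  exact Finset.sum_congr rfl fun _ _ => by ring

section Jet

variable {n : ℕ}

/-- `d_p (∑ᵢ fᵢ aᵢ) = ∑ᵢ (dfᵢ - (∂fᵢ/∂u) c) ∧ aᵢ` for constant forms `aᵢ` with `χ ⌟ aᵢ = 0`. -/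
lemma dproj_sum {ι : Type*} [Fintype ι] {k : ℕ} (f : ι → Vec (2 * n + 1) → ℝ)
    (hf : ∀ i, Differentiable ℝ (f i)) (a : ι → Vec (2 * n + 1) [⋀^Fin (k + 1)]→ₗ[ℝ] ℝ)
    (ha : ∀ i v, a i (Fin.cons chi v) = 0) (x : Vec (2 * n + 1))
    (v : Fin (k + 2) → Vec (2 * n + 1)) :
    dproj (fun y w => ∑ i, f i y * a i w) x v =
      ∑ i, oneWedge (fun w => fderiv ℝ (f i) x w - pd uIdx (f i) x * contact x fun _ => w)
        (a i) v := by
  have h : iprod chi (exd fun y w => ∑ i, f i y * a i w) x =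
      (∑ i, pd uIdx (f i) x • a i : Vec (2 * n + 1) [⋀^Fin (k + 1)]→ₗ[ℝ] ℝ) := by
    rw [coe_sum_smul]
    funext w
    simp only [iprod, exd_sum f hf, oneWedge_cons, ha]
    simp [oneWedge, pd, chi]
  simp only [dproj, proj, Pi.sub_apply]
  rw [reindex_wedge_one_left _ _ _ _ _ h, exd_sum f hf, coe_sum_smul]
  rw [oneWedge_sum_right _ fun i w => pd uIdx (f i) x * a i w]
  simp only [oneWedge_sub_left, oneWedge_smul_left, Finset.sum_sub_distrib, oneWedge_smul_right]

lemma sum_jet_index (g : Fin (2 * n + 1) → ℝ) :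
    ∑ i, g i = ∑ μ : Fin n, g (qIdx μ) + g uIdx + ∑ μ : Fin n, g (pIdx μ) := by
  have h : n + 1 + n = 2 * n + 1 := by omega
  rw [← Equiv.sum_comp (finCongr h), Fin.sum_univ_add, Fin.sum_univ_castSucc]
  rfl

@[simp] lemma basisVec_apply {m : ℕ} (i j : Fin m) : basisVec i j = if j = i then (1 : ℝ) else 0 :=
  Pi.single_apply i 1 j

@[simp] lemma qIdx_inj {μ ν : Fin n} : qIdx μ = qIdx ν ↔ μ = ν := by
  simp [qIdx, Fin.ext_iff]

@[simp] lemma pIdx_inj {μ ν : Fin n} : pIdx μ = pIdx ν ↔ μ = ν := by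
  simp [pIdx, Fin.ext_iff]

@[simp] lemma qIdx_ne_pIdx (μ ν : Fin n) : qIdx μ ≠ pIdx ν := by
  have := μ.isLt
  simp only [qIdx, pIdx, ne_eq, Fin.ext_iff]
  omega

@[simp] lemma pIdx_ne_qIdx (μ ν : Fin n) : pIdx μ ≠ qIdx ν := (qIdx_ne_pIdx ν μ).symm

@[simp] lemma qIdx_ne_uIdx (μ : Fin n) : qIdx μ ≠ uIdx := by
  have := μ.isLt
  simp only [qIdx, uIdx, ne_eq, Fin.ext_iff]
  omega

lemma clm_apply_eq_sum (α : Vec (2 * n + 1) →L[ℝ] ℝ) (w : Vec (2 * n + 1)) :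
    α w = ∑ μ : Fin n, α (basisVec (qIdx μ)) * w (qIdx μ) + α chi * w uIdx +
      ∑ μ : Fin n, α (basisVec (pIdx μ)) * w (pIdx μ) := by
  rw [chi, ← sum_jet_index fun i => α (basisVec i) * w i]
  conv_lhs => rw [pi_eq_sum_univ' w, map_sum]
  refine Finset.sum_congr rfl fun i _ => ?_
  rw [map_smul, smul_eq_mul, mul_comm]
  congr 2

/-- The coordinate expansion of `(df - (∂f/∂u) c) ∧ a`. -/
lemma oneWedge_horizontal {k : ℕ} (f : Vec (2 * n + 1) → ℝ) (x : Vec (2 * n + 1))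
    (a : (Fin k → Vec (2 * n + 1)) → ℝ) (v : Fin (k + 1) → Vec (2 * n + 1)) :
    oneWedge (fun w => fderiv ℝ f x w - pd uIdx f x * contact x fun _ => w) a v =
      ∑ μ : Fin n, (pd (qIdx μ) f x + x (pIdx μ) * pd uIdx f x) *
          oneWedge (fun w => w (qIdx μ)) a v +
        ∑ μ : Fin n, pd (pIdx μ) f x * oneWedge (fun w => w (pIdx μ)) a v := by
  have h : (fun w => fderiv ℝ f x w - pd uIdx f x * contact x fun _ => w) = fun w =>
      ∑ μ : Fin n, (pd (qIdx μ) f x + x (pIdx μ) * pd uIdx f x) * w (qIdx μ) +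
        ∑ μ : Fin n, pd (pIdx μ) f x * w (pIdx μ) := by
    funext w
    rw [clm_apply_eq_sum]
    simp only [contact, pd, chi, add_mul, Finset.sum_add_distrib, mul_sub, Finset.mul_sum]
    have (μ : Fin n) : x (pIdx μ) * fderiv ℝ f x (basisVec uIdx) * w (qIdx μ) =
      fderiv ℝ f x (basisVec uIdx) * (x (pIdx μ) * w (qIdx μ)) := by ring
    simp only [this]
    ring
  rw [h, oneWedge_add_left, oneWedge_sum_left, oneWedge_sum_left]
  simp only [oneWedge_smul_left]

variable (n) in
/-- The volume form `dq¹ ∧ … ∧ dqⁿ` as an alternating map. -/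
def qAlt : Vec (2 * n + 1) [⋀^Fin n]→ₗ[ℝ] ℝ :=
  Matrix.detRowAlternating.compLinearMap (LinearMap.funLeft ℝ ℝ qIdx)

lemma qvol_apply (x : Vec (2 * n + 1)) (v : Fin n → Vec (2 * n + 1)) : qvol x v = qAlt n v := rfl

lemma qAlt_eq_zero {v : Fin n → Vec (2 * n + 1)} (i : Fin n) (h : ∀ j, v i (qIdx j) = 0) :
    qAlt n v = 0 :=
  Matrix.det_eq_zero_of_row_eq_zero i h

lemma oneWedge_dq_qAlt (μ : Fin n) (v : Fin (n + 1) → Vec (2 * n + 1)) :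
    oneWedge (fun w => w (qIdx μ)) (qAlt n) v = 0 := by
  let A : Matrix (Fin (n + 1)) (Fin (n + 1)) ℝ := Matrix.of fun i =>
    Fin.cons (v i (qIdx μ)) fun j => v i (qIdx j)
  have h : A.det = 0 := Matrix.det_zero_of_column_eq (Fin.succ_ne_zero μ).symm fun i => by simp [A]
  rwa [Matrix.det_succ_column_zero] at h

end Jet

section Euler

variable {N : ℕ}

/-- `β_μ` as an alternating map. -/
def betaAlt (μ : Fin (N + 1)) : Vec (2 * (N + 1) + 1) [⋀^Fin N]→ₗ[ℝ] ℝ :=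
  (qAlt (N + 1)).curryLeft (basisVec (qIdx μ))

lemma betaAlt_apply (μ : Fin (N + 1)) (v : Fin N → Vec (2 * (N + 1) + 1)) :
    betaAlt μ v = qAlt (N + 1) (Fin.cons (basisVec (qIdx μ)) v : Fin (N + 1) → _) := rfl

lemma betaAlt_cons_eq_zero (μ : Fin (N + 2)) (w : Vec (2 * (N + 2) + 1))
    (h : ∀ j, w (qIdx j) = 0) (v : Fin N → Vec (2 * (N + 2) + 1)) :
    betaAlt μ (Fin.cons w v : Fin (N + 1) → _) = 0 :=
  qAlt_eq_zero 1 h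

lemma oneWedge_dq_betaAlt (μ ν : Fin (N + 1)) (v : Fin (N + 1) → Vec (2 * (N + 1) + 1)) :
    oneWedge (fun w => w (qIdx μ)) (betaAlt ν) v = if μ = ν then qAlt (N + 1) v else 0 := by
  have h := oneWedge_dq_qAlt μ (Fin.cons (basisVec (qIdx ν)) v : Fin (N + 2) → _)
  rw [oneWedge_cons] at h
  simp only [← betaAlt_apply, basisVec_apply, qIdx_inj] at h
  rw [← sub_eq_zero.mp h]
  simp

lemma dproj_fsmul_qvol {L : Vec (2 * (N + 1) + 1) → ℝ} (hL : Differentiable ℝ L) :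
    dproj (fsmul L qvol) = fun x v =>
      ∑ ν, pd (pIdx ν) L x * oneWedge (fun w => w (pIdx ν)) (qAlt (N + 1)) v := by
  have h : fsmul L qvol = fun y w => ∑ _i : Unit, L y * qAlt (N + 1) w := by
    simp [fsmul, funext_iff, qvol_apply]
  funext x v
  rw [h, dproj_sum _ (fun _ => hL) _ fun _ v => qAlt_eq_zero 0 fun j => by simp [chi]]
  simp [oneWedge_horizontal, oneWedge_dq_qAlt]

/-- `⊥ d_p (L β) = -∑ (∂L/∂p_μ) β_μ`. -/
lemma botOp_dproj_fsmul_qvol {L : Vec (2 * (N + 2) + 1) → ℝ} (hL : Differentiable ℝ L) :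
    botOp (dproj (fsmul L qvol)) = fun x (v : Fin (N + 1) → _) =>
      ∑ μ, -pd (pIdx μ) L x * betaAlt μ v := by
  rw [dproj_fsmul_qvol hL]
  funext x v
  simp only [botOp, Finset.sum_apply]
  refine Finset.sum_congr rfl fun μ _ => ?_
  have h (ν : Fin (N + 2)) : oneWedge (fun w => w (pIdx ν)) (qAlt (N + 2))
      (Fin.cons (basisVec (qIdx μ)) (Fin.cons (basisVec (pIdx μ)) v : Fin (N + 2) → _) :
        Fin (N + 3) → _) = if ν = μ then -betaAlt μ v else 0 := by
    simp only [oneWedge_cons, ← betaAlt_apply]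
    rw [show (fun v' => betaAlt μ (Fin.cons (basisVec (pIdx μ)) v' : Fin (N + 1) → _)) =
      fun _ => 0 from funext (betaAlt_cons_eq_zero μ _ fun j => by simp)]
    by_cases hμ : ν = μ <;> simp [oneWedge, hμ]
  calc _ = ∑ ν, pd (pIdx ν) L x * (if ν = μ then -betaAlt μ v else 0) :=
        Finset.sum_congr rfl fun ν _ => by rw [← h ν]
    _ = _ := by simp

lemma pd_pd_comm {m : ℕ} {L : Vec m → ℝ} (hL : ContDiff ℝ (⊤ : ℕ∞) L) (i j : Fin m) (x : Vec m) :
    pd i (pd j L) x = pd j (pd i L) x := by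
  have hd : Differentiable ℝ (fderiv ℝ L) :=
    (hL.fderiv_right (m := 1) (by norm_cast)).differentiable one_ne_zero
  have h (i j : Fin m) : pd i (pd j L) x = fderiv ℝ (fderiv ℝ L) x (basisVec i) (basisVec j) := by
    unfold pd
    rw [fderiv_clm_apply hd.differentiableAt (differentiableAt_const _)]
    simp
  rw [h, h]
  exact (hL.contDiffAt.isSymmSndFDerivAt (by
    rw [minSmoothness_of_isRCLikeNormedField]
    exact WithTop.coe_le_coe.2 le_top)).eq _ _

lemma differentiable_pd {m : ℕ} {L : Vec m → ℝ} (hL : ContDiff ℝ (⊤ : ℕ∞) L) (i : Fin m) :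
    Differentiable ℝ (pd i L) :=
  ((hL.fderiv_right (m := 1) (by norm_cast)).differentiable one_ne_zero).clm_apply
    (differentiable_const _)

lemma pd_neg {m : ℕ} (i : Fin m) (f : Vec m → ℝ) (x : Vec m) :
    pd i (fun y => -f y) x = -pd i f x := by
  simp [pd]

/-- `d_p ⊥ d_p (L β)` in coordinates. -/
lemma dproj_botOp_dproj_fsmul_qvol {L : Vec (2 * (N + 2) + 1) → ℝ}
    (hL : ContDiff ℝ (⊤ : ℕ∞) L) (x : Vec (2 * (N + 2) + 1))
    (v : Fin (N + 2) → Vec (2 * (N + 2) + 1)) :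
    dproj (botOp (dproj (fsmul L qvol))) x v =
      -(∑ μ, (pd (qIdx μ) (pd (pIdx μ) L) x + x (pIdx μ) * pd uIdx (pd (pIdx μ) L) x)) *
          qAlt (N + 2) v -
        ∑ μ, ∑ ν, pd (pIdx μ) (pd (pIdx ν) L) x *
          oneWedge (fun w => w (pIdx ν)) (betaAlt μ) v := by
  rw [botOp_dproj_fsmul_qvol (hL.differentiable (by simp))]
  have hterm (μ : Fin (N + 2)) :
      oneWedge (fun w => fderiv ℝ (fun y => -pd (pIdx μ) L y) x w -
          pd uIdx (fun y => -pd (pIdx μ) L y) x * contact x fun _ => w) (betaAlt μ) v =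
        -((pd (qIdx μ) (pd (pIdx μ) L) x + x (pIdx μ) * pd uIdx (pd (pIdx μ) L) x) *
          qAlt (N + 2) v) -
        ∑ ν, pd (pIdx μ) (pd (pIdx ν) L) x * oneWedge (fun w => w (pIdx ν)) (betaAlt μ) v := by
    rw [oneWedge_horizontal]
    simp only [oneWedge_dq_betaAlt, pd_neg, mul_ite, mul_zero, Finset.sum_ite_eq', Finset.mem_univ,
      if_true, neg_mul, Finset.sum_neg_distrib, pd_pd_comm hL (pIdx μ)]
    ring
  calc _ = _ := dproj_sum (fun μ y => -pd (pIdx μ) L y) (fun μ => (differentiable_pd hL _).neg)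
        betaAlt (fun μ => betaAlt_cons_eq_zero μ chi fun j => by simp [chi]) x v
    _ = _ := by
      rw [Finset.sum_congr rfl fun μ _ => hterm μ, Finset.sum_sub_distrib, Finset.sum_neg_distrib,
        neg_mul, Finset.sum_mul]

end Euler

/-- coordinate expression of the Euler operator applied to a first-order
Lagrangian form `L·β` (n even):
`E(Lβ) = Σ_{μ,ν} L_{p_μ p_ν} β_μ ∧ dp_ν − (Σ_μ L_{q^μ p_μ} + Σ_μ p_μ L_{u p_μ} − L_u) β`. -/
theorem euler_coordinate_formula (n : ℕ) (hn : Even n)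
    (L : Vec (2 * n + 1) → ℝ) (hL : ContDiff ℝ (⊤ : ℕ∞) L) :
    euler (fsmul L qvol) =
      (∑ μ : Fin n, ∑ ν : Fin n,
        fsmul (pd (pIdx μ) (pd (pIdx ν) L))
          (reindex (show n - 1 + 1 = n by have := μ.isLt; omega)
            (wedge (betaMu μ) (dx (pIdx ν))))) -
      fsmul (fun x =>
          (∑ μ : Fin n, pd (qIdx μ) (pd (pIdx μ) L) x) +
          (∑ μ : Fin n, x (pIdx μ) * pd (uIdx (n := n)) (pd (pIdx μ) L) x) -
          pd (uIdx (n := n)) L x) qvol := by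
  obtain _ | _ | N := n
  · funext x v
    simp [euler, lieChi, fsmul, qvol, pd, chi]
  · exact absurd hn (by decide)
  · have hN : (-1 : ℝ) ^ (N + 1) = -1 := Odd.neg_one_pow (by
      rw [← Nat.not_even_iff_odd, ← Nat.even_add_one]; exact hn)
    funext x v
    have hlie : lieChi (fsmul L qvol) x v = pd uIdx L x * qAlt (N + 2) v := by
      simp only [lieChi, fsmul, qvol_apply]
      rw [fderiv_mul_const (hL.differentiable (by simp)).differentiableAt]
      simp [pd, chi, mul_comm]
    have hwedge (μ ν : Fin (N + 2)) : wedge (betaMu μ) (dx (pIdx ν)) x v =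
        -oneWedge (fun w => w (pIdx ν)) (betaAlt μ) v := by
      rw [← neg_one_mul, ← hN]
      exact wedge_one_right (betaMu μ) (dx (pIdx ν)) x (betaAlt μ) rfl v
    calc _ = dproj (botOp (dproj (fsmul L qvol))) x v + lieChi (fsmul L qvol) x v := rfl
      _ = (∑ μ, ∑ ν, pd (pIdx μ) (pd (pIdx ν) L) x * wedge (betaMu μ) (dx (pIdx ν)) x v) -
          (∑ μ, pd (qIdx μ) (pd (pIdx μ) L) x +
            ∑ μ, x (pIdx μ) * pd uIdx (pd (pIdx μ) L) x - pd uIdx L x) * qAlt (N + 2) v := by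
        rw [dproj_botOp_dproj_fsmul_qvol hL, hlie]
        simp only [hwedge, mul_neg, Finset.sum_neg_distrib, Finset.sum_add_distrib]
        ring
      _ = _ := by
        simp only [Pi.sub_apply, Finset.sum_apply]
        rfl

end MA
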